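/- Let A be an associative algebra over a field of characteristic zero and let (u_k)_{k≥1} be a sequence in A. Then the families (Q^{(k)})_{k≥0} and (R^{(k)})_{k≥0} are formal inverses of each other: for every k ≥ 1, Σ_{m=0}^{k} Q^{(m)} ∘ R^{(k−m)} = 0 and Σ_{m=0}^{k} R^{(m)} ∘ Q^{(k−m)} = 0 as linear maps A → A. -/

import Mathlib

noncomputable section

variable (F : Type*) [Field F] [CharZero F] {A : Type*} [Ring A] [Algebra F A]

/-- `ad_u : A → A`, `ad_u(a) = u a − a u`, as an `F`-linear map. -/
def adL (u : A) : Module.End F A :=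
  LinearMap.mulLeft F u - LinearMap.mulRight F u

/-- The index set `π(k)` of `k`-tuples `(j₁,…,j_k)` of non-negative integers with
`Σ_l l·j_l = k` (each component is then automatically `≤ k`, so we realise the tuples as
functions `Fin k → Fin (k+1)`, `j l` encoding `j_{l+1}`). -/
def pik (k : ℕ) : Finset (Fin k → Fin (k + 1)) :=
  Finset.univ.filter fun j => ∑ l, (l.1 + 1) * (j l).1 = k

/-- `Q^{(k)} = Σ_{j ∈ π(k)} (j₁!⋯j_k!)^{−1} ad_{u_k}^{j_k} ∘ ⋯ ∘ ad_{u_1}^{j_1}`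
(with `Q^{(0)} = id`). -/
def Qop (u : ℕ → A) (k : ℕ) : Module.End F A :=
  ∑ j ∈ pik k, (((∏ l, Nat.factorial (j l).1 : ℕ) : F)⁻¹ : F) •
    ((List.finRange k).reverse.map fun l => adL F (u (l.1 + 1)) ^ (j l).1).prod

/-- `R^{(k)} = Σ_{j ∈ π(k)} ((−1)^{j₁+⋯+j_k} / (j₁!⋯j_k!)) ad_{u_1}^{j_1} ∘ ⋯ ∘ ad_{u_k}^{j_k}`
(with `R^{(0)} = id`). -/
def Rop (u : ℕ → A) (k : ℕ) : Module.End F A :=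
  ∑ j ∈ pik k, ((-1 : F) ^ (∑ l, (j l).1) * (((∏ l, Nat.factorial (j l).1 : ℕ) : F)⁻¹ : F)) •
    ((List.finRange k).map fun l => adL F (u (l.1 + 1)) ^ (j l).1).prod

open Polynomial

/-- A product of sums over `Fin m`, in increasing order of the index, expands as a sum over
functions. -/
theorem prod_finRange_sum {S : Type*} [Semiring S] {m : ℕ} :
    ∀ (n : ℕ) (f : Fin n → Fin m → S),
      ((List.finRange n).map fun l => ∑ i, f l i).prod =
        ∑ j : Fin n → Fin m, ((List.finRange n).map fun l => f l (j l)).prod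
  | 0, f => by simp
  | n + 1, f => by
    rw [← (Fin.consEquiv fun _ => Fin m).sum_comp, Fintype.sum_prod_type]
    simp only [List.finRange_succ, List.map_cons, List.map_map, List.prod_cons, Function.comp_def,
      Fin.consEquiv_apply, Fin.cons_zero, Fin.cons_succ]
    rw [prod_finRange_sum n fun l => f l.succ, Finset.sum_mul_sum]

/-- A product of sums over `Fin m`, in decreasing order of the index, expands as a sum over
functions. -/
theorem prod_finRange_reverse_sum {S : Type*} [Semiring S] {m : ℕ} :
    ∀ (n : ℕ) (f : Fin n → Fin m → S),
      ((List.finRange n).reverse.map fun l => ∑ i, f l i).prod =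
        ∑ j : Fin n → Fin m, ((List.finRange n).reverse.map fun l => f l (j l)).prod
  | 0, f => by simp
  | n + 1, f => by
    rw [← (Fin.consEquiv fun _ => Fin m).sum_comp, Fintype.sum_prod_type_right]
    have ih := prod_finRange_reverse_sum n fun l => f l.succ
    simp only [List.map_reverse] at ih
    simp only [List.finRange_succ, List.reverse_cons, List.map_append, List.map_cons, List.map_nil,
      List.map_reverse, List.map_map, List.prod_append, List.prod_singleton, Function.comp_def,
      Fin.consEquiv_apply, Fin.cons_zero, Fin.cons_succ]
    rw [ih, Finset.sum_mul_sum]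

section Polynomials

variable {K E : Type*} [Field K] [Ring E] [Algebra K E]

theorem prod_map_monomial_smul {ι : Type*} (L : List ι) (d : ι → ℕ) (c : ι → K) (b : ι → E) :
    (L.map fun l => monomial (d l) (c l • b l)).prod =
      monomial (L.map d).sum ((L.map c).prod • (L.map b).prod) := by
  induction L with
  | nil => simp
  | cons x L ih =>
    simp only [List.map_cons, List.prod_cons, List.sum_cons, ih, monomial_mul_monomial,
      smul_mul_smul_comm]

/-- Two polynomials agree up to degree `N`. -/
def AgreeUpTo (N : ℕ) (p q : E[X]) : Prop := ∀ n ≤ N, p.coeff n = q.coeff n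

namespace AgreeUpTo

variable {N : ℕ} {p q r p' q' : E[X]}

theorem refl (N : ℕ) (p : E[X]) : AgreeUpTo N p p := fun _ _ => rfl

theorem trans (h : AgreeUpTo N p q) (h' : AgreeUpTo N q r) : AgreeUpTo N p r :=
  fun n hn => (h n hn).trans (h' n hn)

theorem mul (h : AgreeUpTo N p q) (h' : AgreeUpTo N p' q') : AgreeUpTo N (p * p') (q * q') := by
  intro n hn
  rw [coeff_mul, coeff_mul]
  refine Finset.sum_congr rfl fun x hx => ?_
  have := Finset.HasAntidiagonal.mem_antidiagonal.1 hx
  rw [h x.1 (by omega), h' x.2 (by omega)]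

theorem list_prod {ι : Type*} (L : List ι) {f g : ι → E[X]} (h : ∀ l, AgreeUpTo N (f l) (g l)) :
    AgreeUpTo N (L.map f).prod (L.map g).prod := by
  induction L with
  | nil => exact refl _ _
  | cons x L ih => simpa using (h x).mul ih

end AgreeUpTo

/-- The exponential of `s a X ^ l`, truncated after the term of index `N`. -/
def truncExp (s : K) (N l : ℕ) (a : E) : E[X] :=
  ∑ i : Fin (N + 1), monomial (l * i) ((s ^ (i : ℕ) * ((Nat.factorial i : ℕ) : K)⁻¹) • a ^ (i : ℕ))

theorem truncExp_eq_sum_range (s : K) (N l : ℕ) (a : E) :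
    truncExp s N l a = ∑ i ∈ Finset.range (N + 1),
      monomial (l * i) ((s ^ i * ((Nat.factorial i : ℕ) : K)⁻¹) • a ^ i) :=
  Fin.sum_univ_eq_sum_range
    (fun i => monomial (l * i) ((s ^ i * ((Nat.factorial i : ℕ) : K)⁻¹) • a ^ i)) (N + 1)

theorem agreeUpTo_truncExp (s : K) {N M l : ℕ} (h : N ≤ M) (hl : 1 ≤ l) (a : E) :
    AgreeUpTo N (truncExp s N l a) (truncExp s M l a) := by
  intro n hn
  rw [truncExp_eq_sum_range, truncExp_eq_sum_range, finsetSum_coeff, finsetSum_coeff]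
  refine Finset.sum_subset (Finset.range_mono (by omega)) fun i _ hi => ?_
  rw [Finset.mem_range] at hi
  exact coeff_monomial_of_ne _ (by nlinarith)

theorem agreeUpTo_truncExp_one (s : K) {N M l : ℕ} (h : N < l) (a : E) :
    AgreeUpTo N (truncExp s M l a) 1 := by
  intro n hn
  rw [truncExp_eq_sum_range, finsetSum_coeff, Finset.sum_range_succ', Finset.sum_eq_zero]
  · simp [coeff_one]
  · intro i _
    exact coeff_monomial_of_ne _ (by nlinarith)

theorem truncExp_eq_aeval [CharZero K] (s : K) (N l : ℕ) (a : E) :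
    truncExp s N l a = aeval (monomial l a)
      (PowerSeries.trunc (N + 1) (PowerSeries.rescale s (PowerSeries.exp K))) := by
  rw [truncExp_eq_sum_range, PowerSeries.trunc_apply, Nat.Ico_zero_eq_range, map_sum]
  refine Finset.sum_congr rfl fun i _ => ?_
  rw [aeval_monomial, monomial_pow, ← Algebra.smul_def, smul_monomial]
  simp [PowerSeries.coeff_exp]

theorem truncExp_mul_truncExp_neg [CharZero K] (s : K) (N : ℕ) {l : ℕ} (hl : 1 ≤ l) (a : E) :
    AgreeUpTo N (truncExp s N l a * truncExp (-s) N l a) 1 := by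
  obtain ⟨r, hr⟩ : (X : K[X]) ^ (N + 1) ∣
      PowerSeries.trunc (N + 1) (PowerSeries.rescale s (PowerSeries.exp K)) *
        PowerSeries.trunc (N + 1) (PowerSeries.rescale (-s) (PowerSeries.exp K)) - 1 := by
    refine X_pow_dvd_iff.2 fun d hd => ?_
    have h := congrArg (PowerSeries.coeff d)
      (PowerSeries.exp_mul_exp_eq_exp_add (A := K) s (-s))
    rw [add_neg_cancel, PowerSeries.rescale_zero_apply, PowerSeries.constantCoeff_exp, map_one,
      PowerSeries.coeff_mul, PowerSeries.coeff_one] at h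
    rw [coeff_sub, coeff_mul, coeff_one, sub_eq_zero, ← h]
    refine Finset.sum_congr rfl fun x hx => ?_
    have := Finset.HasAntidiagonal.mem_antidiagonal.1 hx
    rw [PowerSeries.coeff_trunc, PowerSeries.coeff_trunc, if_pos (by omega), if_pos (by omega)]
  intro n hn
  rw [truncExp_eq_aeval, truncExp_eq_aeval, ← map_mul, sub_eq_iff_eq_add.1 hr, map_add, map_one,
    map_mul, map_pow, aeval_X, monomial_pow, coeff_add, coeff_mul, Finset.sum_eq_zero, zero_add]
  intro x hx
  have := Finset.HasAntidiagonal.mem_antidiagonal.1 hx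
  rw [coeff_monomial_of_ne _ (by nlinarith), zero_mul]

/-- The product of the truncated exponentials of `s a₁ X, …, s a_n X ^ n`, in increasing order. -/
def expProd (s : K) (N n : ℕ) (a : ℕ → E) : E[X] :=
  ((List.range n).map fun l => truncExp s N (l + 1) (a (l + 1))).prod

/-- The product of the truncated exponentials of `s a₁ X, …, s a_n X ^ n`, in decreasing order. -/
def expProdRev (s : K) (N n : ℕ) (a : ℕ → E) : E[X] :=
  ((List.range n).reverse.map fun l => truncExp s N (l + 1) (a (l + 1))).prod

theorem expProd_succ (s : K) (N n : ℕ) (a : ℕ → E) :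
    expProd s N (n + 1) a = expProd s N n a * truncExp s N (n + 1) (a (n + 1)) := by
  simp [expProd, List.range_succ]

theorem expProdRev_succ (s : K) (N n : ℕ) (a : ℕ → E) :
    expProdRev s N (n + 1) a = truncExp s N (n + 1) (a (n + 1)) * expProdRev s N n a := by
  simp [expProdRev, List.range_succ]

theorem agreeUpTo_expProd (s : K) {m k : ℕ} (h : m ≤ k) (a : ℕ → E) :
    AgreeUpTo m (expProd s m m a) (expProd s k k a) := by
  have extend : ∀ n, m ≤ n → AgreeUpTo m (expProd s k m a) (expProd s k n a) := by
    intro n hn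
    induction n, hn using Nat.le_induction with
    | base => exact .refl _ _
    | succ n hn ih =>
      intro d hd
      rw [expProd_succ, (AgreeUpTo.refl m _).mul
        (agreeUpTo_truncExp_one s (Nat.lt_succ_of_le hn) _) d hd, mul_one, ih d hd]
  exact (AgreeUpTo.list_prod _ fun l => agreeUpTo_truncExp s h (by omega) _).trans (extend k h)

theorem agreeUpTo_expProdRev (s : K) {m k : ℕ} (h : m ≤ k) (a : ℕ → E) :
    AgreeUpTo m (expProdRev s m m a) (expProdRev s k k a) := by
  have extend : ∀ n, m ≤ n → AgreeUpTo m (expProdRev s k m a) (expProdRev s k n a) := by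
    intro n hn
    induction n, hn using Nat.le_induction with
    | base => exact .refl _ _
    | succ n hn ih =>
      intro d hd
      rw [expProdRev_succ, (agreeUpTo_truncExp_one s (Nat.lt_succ_of_le hn) _).mul
        (AgreeUpTo.refl m _) d hd, one_mul, ih d hd]
  exact (AgreeUpTo.list_prod _ fun l => agreeUpTo_truncExp s h (by omega) _).trans (extend k h)

theorem expProdRev_mul_expProd_neg [CharZero K] (s : K) (N n : ℕ) (a : ℕ → E) :
    AgreeUpTo N (expProdRev s N n a * expProd (-s) N n a) 1 := by
  induction n with
  | zero => simpa [expProd, expProdRev] using AgreeUpTo.refl N 1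
  | succ n ih =>
    have h := ((AgreeUpTo.refl N (truncExp s N (n + 1) (a (n + 1)))).mul ih).mul
      (AgreeUpTo.refl N (truncExp (-s) N (n + 1) (a (n + 1))))
    rw [mul_one] at h
    rw [expProdRev_succ, expProd_succ]
    simpa only [mul_assoc] using h.trans (truncExp_mul_truncExp_neg s N (by omega) _)

theorem expProd_mul_expProdRev_neg [CharZero K] (s : K) (N n : ℕ) (a : ℕ → E) :
    AgreeUpTo N (expProd s N n a * expProdRev (-s) N n a) 1 := by
  induction n with
  | zero => simpa [expProd, expProdRev] using AgreeUpTo.refl N 1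
  | succ n ih =>
    have h := ((AgreeUpTo.refl N (expProd s N n a)).mul
      (truncExp_mul_truncExp_neg s N (Nat.le_add_left 1 n) (a (n + 1)))).mul
      (AgreeUpTo.refl N (expProdRev (-s) N n a))
    rw [mul_one] at h
    rw [expProd_succ, expProdRev_succ]
    simpa only [mul_assoc] using h.trans ih

theorem coeff_expProd (s : K) (N n k : ℕ) (a : ℕ → E) :
    (expProd s N n a).coeff k =
      ∑ j : Fin n → Fin (N + 1) with ∑ l, (l.1 + 1) * (j l).1 = k,
        (s ^ (∑ l, (j l).1) * ((∏ l, Nat.factorial (j l).1 : ℕ) : K)⁻¹) •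
          ((List.finRange n).map fun l => a (l.1 + 1) ^ (j l).1).prod := by
  have h : expProd s N n a =
      ((List.finRange n).map fun l => truncExp s N (l.1 + 1) (a (l.1 + 1))).prod := by
    rw [expProd, ← List.map_coe_finRange_eq_range, List.map_map]; rfl
  have hsum (d : Fin n → ℕ) : ((List.finRange n).map d).sum = ∑ l, d l := by
    rw [← List.ofFn_eq_map, List.sum_ofFn]
  have hprod (c : Fin n → K) : ((List.finRange n).map c).prod = ∏ l, c l := by
    rw [← List.ofFn_eq_map, List.prod_ofFn]
  simp only [h, truncExp, prod_finRange_sum, prod_map_monomial_smul, finsetSum_coeff,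
    coeff_monomial, hsum, hprod, Finset.prod_mul_distrib,
    Finset.prod_pow_eq_pow_sum, Finset.prod_inv_distrib, Nat.cast_prod, Finset.sum_filter]

theorem coeff_expProdRev (s : K) (N n k : ℕ) (a : ℕ → E) :
    (expProdRev s N n a).coeff k =
      ∑ j : Fin n → Fin (N + 1) with ∑ l, (l.1 + 1) * (j l).1 = k,
        (s ^ (∑ l, (j l).1) * ((∏ l, Nat.factorial (j l).1 : ℕ) : K)⁻¹) •
          ((List.finRange n).reverse.map fun l => a (l.1 + 1) ^ (j l).1).prod := by
  have h : expProdRev s N n a =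
      ((List.finRange n).reverse.map fun l => truncExp s N (l.1 + 1) (a (l.1 + 1))).prod := by
    rw [expProdRev, ← List.map_coe_finRange_eq_range, ← List.map_reverse, List.map_map]; rfl
  have hsum (d : Fin n → ℕ) : ((List.finRange n).reverse.map d).sum = ∑ l, d l := by
    rw [List.map_reverse, List.sum_reverse, ← List.ofFn_eq_map, List.sum_ofFn]
  have hprod (c : Fin n → K) : ((List.finRange n).reverse.map c).prod = ∏ l, c l := by
    rw [List.map_reverse, (List.reverse_perm _).prod_eq, ← List.ofFn_eq_map, List.prod_ofFn]
  simp only [h, truncExp, prod_finRange_reverse_sum, prod_map_monomial_smul, finsetSum_coeff,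
    coeff_monomial, hsum, hprod, Finset.prod_mul_distrib,
    Finset.prod_pow_eq_pow_sum, Finset.prod_inv_distrib, Nat.cast_prod, Finset.sum_filter]

end Polynomials

omit [CharZero F] in
theorem Qop_eq_coeff (u : ℕ → A) {m k : ℕ} (h : m ≤ k) :
    Qop F u m = (expProdRev (1 : F) k k fun l => adL F (u l)).coeff m := by
  rw [← agreeUpTo_expProdRev (1 : F) h _ m le_rfl, coeff_expProdRev]
  simp only [one_pow, one_mul]
  rfl

omit [CharZero F] in
theorem Rop_eq_coeff (u : ℕ → A) {m k : ℕ} (h : m ≤ k) :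
    Rop F u m = (expProd (-1 : F) k k fun l => adL F (u l)).coeff m := by
  rw [← agreeUpTo_expProd (-1 : F) h _ m le_rfl, coeff_expProd]
  rfl

/-- The families `(Q^{(k)})` and `(R^{(k)})` are formal inverses of each
other: for every `k ≥ 1`, `Σ_{m=0}^{k} Q^{(m)} ∘ R^{(k−m)} = 0` and
`Σ_{m=0}^{k} R^{(m)} ∘ Q^{(k−m)} = 0`. -/
theorem Q_R_formal_inverses (u : ℕ → A) :
    ∀ k : ℕ, 1 ≤ k →
      (∑ m ∈ Finset.range (k + 1), Qop F u m * Rop F u (k - m)) = 0 ∧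
      (∑ m ∈ Finset.range (k + 1), Rop F u m * Qop F u (k - m)) = 0 := by
  intro k hk
  have hQR := expProdRev_mul_expProd_neg (1 : F) k k (fun l => adL F (u l)) k le_rfl
  have hRQ := expProd_mul_expProdRev_neg (-1 : F) k k (fun l => adL F (u l)) k le_rfl
  rw [coeff_mul, Finset.Nat.sum_antidiagonal_eq_sum_range_succ_mk, coeff_one,
    if_neg (by omega)] at hQR hRQ
  rw [neg_neg] at hRQ
  constructor
  · rw [← hQR]
    refine Finset.sum_congr rfl fun m hm => ?_
    rw [Qop_eq_coeff F u (Finset.mem_range_succ_iff.1 hm), Rop_eq_coeff F u (Nat.sub_le k m)]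
  · rw [← hRQ]
    refine Finset.sum_congr rfl fun m hm => ?_
    rw [Rop_eq_coeff F u (Finset.mem_range_succ_iff.1 hm), Qop_eq_coeff F u (Nat.sub_le k m)]
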